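/- arXiv:math/0501096 — 2 statements merged into one kernel-verified Lean document; each statement's English description precedes it below -/
import Mathlib

section
/- Let H be a real Hilbert space and let m > -1 be a real number. Then there exists a constant C > 0, depending only on m, such that for every a ∈ (1/2, 1) and every measurable ω : (0,1) → H with ∫₀¹ ‖ω(s)‖² s^m ds < ∞, the function r ↦ ∫_a^r ω(s) ds (a Bochner integral, with the convention ∫_a^r = -∫_r^a for r < a; ω is automatically integrable on any compact subinterval of (0,1)) satisfies ∫₀¹ ‖∫_a^r ω(s) ds‖² r^m dr ≤ C · ∫₀¹ ‖ω(s)‖² s^m ds. -/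
open MeasureTheory Set

theorem lintegral_Ioo_zero_rpow {κ b : ℝ} (hκ : 0 < κ) (hb : 0 < b) :
    ∫⁻ r in Ioo 0 b, ENNReal.ofReal (r ^ (κ - 1)) = ENNReal.ofReal (b ^ κ / κ) := by
  have hint : IntegrableOn (fun r : ℝ => r ^ (κ - 1)) (Ioc 0 b) := by
    rw [← intervalIntegrable_iff_integrableOn_Ioc_of_le hb.le]
    exact intervalIntegral.intervalIntegrable_rpow' (by linarith)
  have hval : ∫ r in Ioc 0 b, r ^ (κ - 1) = b ^ κ / κ := by
    rw [← intervalIntegral.integral_of_le hb.le, integral_rpow (Or.inl (by linarith))]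
    simp [Real.zero_rpow hκ.ne']
  rw [setLIntegral_congr Ioo_ae_eq_Ioc, ← hval, ofReal_integral_eq_lintegral_ofReal hint]
  filter_upwards [ae_restrict_mem measurableSet_Ioc] with r hr
  exact Real.rpow_nonneg hr.1.le _

theorem lintegral_Ioi_rpow {κ b : ℝ} (hκ : 0 < κ) (hb : 0 < b) :
    ∫⁻ s in Ioi b, ENNReal.ofReal (s ^ (-1 - κ)) = ENNReal.ofReal (b ^ (-κ) / κ) := by
  have hval := integral_Ioi_rpow_of_lt (show -1 - κ < -1 by linarith) hb
  rw [show -1 - κ + 1 = -κ by ring, neg_div_neg_eq] at hval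
  rw [← hval, ofReal_integral_eq_lintegral_ofReal
    (integrableOn_Ioi_rpow_of_lt (by linarith) hb)]
  filter_upwards [ae_restrict_mem measurableSet_Ioi] with s hs
  exact Real.rpow_nonneg (hb.trans hs).le _

/-- The Cauchy-Schwarz inequality for lower Lebesgue integrals. -/
theorem lintegral_mul_sq_le {α : Type*} [MeasurableSpace α] {μ : Measure α}
    {f g : α → ENNReal} (hf : AEMeasurable f μ) (hg : AEMeasurable g μ) :
    (∫⁻ x, f x * g x ∂μ) ^ 2 ≤ (∫⁻ x, f x ^ 2 ∂μ) * ∫⁻ x, g x ^ 2 ∂μ := by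
  have h := ENNReal.lintegral_mul_le_Lp_mul_Lq μ Real.HolderConjugate.two_two hf hg
  have h2 := pow_le_pow_left' h 2
  simp only [mul_pow, Pi.mul_apply, ← ENNReal.rpow_natCast, ← ENNReal.rpow_mul] at h2
  simpa using h2

/-- A pointwise bound on the homotopy operator by the Cauchy-Schwarz inequality with weight
`s ^ (1 + κ)`. -/
theorem enorm_intervalIntegral_sq_le {H : Type*} [NormedAddCommGroup H] [NormedSpace ℝ H]
    {κ a r : ℝ} (hκ : 0 < κ) (ha : a ∈ Ioo (1 / 2 : ℝ) 1) (hr : r ∈ Ioo (0 : ℝ) 1)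
    {ω : ℝ → H} (hω : StronglyMeasurable ω) :
    ‖∫ s in a..r, ω s‖ₑ ^ 2 ≤ ENNReal.ofReal ((r / 2) ^ (-κ) / κ) *
      ∫⁻ s in Ioo (r / 2) 1, ENNReal.ofReal (‖ω s‖ ^ 2 * s ^ (1 + κ)) := by
  have hr0 : 0 < r / 2 := half_pos hr.1
  have hsub : Set.uIoc a r ⊆ Ioo (r / 2) 1 := by
    intro s hs
    rw [Set.mem_uIoc] at hs
    obtain ⟨h1, h2⟩ := ha
    obtain ⟨h3, h4⟩ := hr
    constructor <;> rcases hs with hs | hs <;> linarith [hs.1, hs.2]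
  have h1 : ‖∫ s in a..r, ω s‖ₑ ≤ ∫⁻ s in Ioo (r / 2) 1,
      ENNReal.ofReal (s ^ ((-1 - κ) / 2)) * ENNReal.ofReal (‖ω s‖ * s ^ ((1 + κ) / 2)) := by
    calc ‖∫ s in a..r, ω s‖ₑ = ‖∫ s in Set.uIoc a r, ω s‖ₑ := by
          rw [← ofReal_norm, ← ofReal_norm, intervalIntegral.norm_intervalIntegral_eq]
      _ ≤ ∫⁻ s in Set.uIoc a r, ‖ω s‖ₑ := enorm_integral_le_lintegral_enorm _
      _ ≤ ∫⁻ s in Ioo (r / 2) 1, ‖ω s‖ₑ := lintegral_mono_set hsub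
      _ = _ := by
          refine setLIntegral_congr_fun measurableSet_Ioo fun s hs => ?_
          have hs0 : 0 < s := hr0.trans hs.1
          rw [← ENNReal.ofReal_mul (by positivity), ← ofReal_norm]
          congr 1
          rw [mul_left_comm, ← Real.rpow_add hs0,
            show (-1 - κ) / 2 + (1 + κ) / 2 = 0 by ring, Real.rpow_zero, mul_one]
  have hm := hω.norm.measurable
  refine (pow_le_pow_left' h1 2).trans ((lintegral_mul_sq_le (by fun_prop) (by fun_prop)).trans ?_)
  rw [← lintegral_Ioi_rpow hκ hr0]
  refine mul_le_mul' (le_trans (le_of_eq ?_) (lintegral_mono_set (Ioo_subset_Ioi_self (a := 1))))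
    (le_of_eq ?_) <;>
  · refine setLIntegral_congr_fun measurableSet_Ioo fun s hs => ?_
    have hs0 : 0 < s := hr0.trans hs.1
    rw [← ENNReal.ofReal_pow (by positivity)]
    congr 1
    have hsq (x : ℝ) : (s ^ (x / 2)) ^ 2 = s ^ x := by
      rw [← Real.rpow_mul_natCast hs0.le, Nat.cast_ofNat, div_mul_cancel₀ x two_ne_zero]
    simp only [mul_pow, hsq]

/-- Uniform boundedness of the homotopy operator `K_a(ω)(r) = ∫_a^r ω(s) ds` on the
weighted space `L²_m` for `m > -1`, with a constant depending only on `m`, uniformly in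
`a ∈ (1/2,1)`. -/
theorem homotopy_operator_bounded {H : Type*} [NormedAddCommGroup H]
    [InnerProductSpace ℝ H] [CompleteSpace H] (m : ℝ) (hm : -1 < m) :
    ∃ C : ℝ, 0 < C ∧ ∀ a ∈ Ioo (1/2 : ℝ) 1, ∀ ω : ℝ → H, StronglyMeasurable ω →
      (∫⁻ s in Ioo (0:ℝ) 1, ENNReal.ofReal (‖ω s‖ ^ 2 * s ^ m)) < ⊤ →
      (∫⁻ r in Ioo (0:ℝ) 1, ENNReal.ofReal (‖∫ s in a..r, ω s‖ ^ 2 * r ^ m)) ≤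
        ENNReal.ofReal C * ∫⁻ s in Ioo (0:ℝ) 1, ENNReal.ofReal (‖ω s‖ ^ 2 * s ^ m) := by
  obtain ⟨κ, hκ, rfl⟩ : ∃ κ : ℝ, 0 < κ ∧ m = 2 * κ - 1 :=
    ⟨(m + 1) / 2, by linarith, by ring⟩
  refine ⟨2 ^ κ / κ * (2 ^ κ / κ), by positivity, fun a ha ω hω _ => ?_⟩
  have hωm := hω.norm.measurable
  set c : ENNReal := ENNReal.ofReal (2 ^ κ / κ) with hc
  set φ : ℝ → ENNReal := fun s => ENNReal.ofReal (‖ω s‖ ^ 2 * s ^ (1 + κ)) with hφ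
  have hφm : Measurable φ := by fun_prop
  set S : Set (ℝ × ℝ) := {p | p.1 < 2 * p.2} with hS
  have hSm : MeasurableSet S := measurableSet_lt (by fun_prop) (by fun_prop)
  set F : ℝ → ℝ → ENNReal := fun r s =>
    S.indicator (fun p => c * ENNReal.ofReal (p.1 ^ (κ - 1)) * φ p.2) (r, s) with hF
  have hFm : Measurable (Function.uncurry F) := by
    have : Measurable fun p : ℝ × ℝ => c * ENNReal.ofReal (p.1 ^ (κ - 1)) * φ p.2 := by
      fun_prop
    exact this.indicator hSm
  calc (∫⁻ r in Ioo (0:ℝ) 1, ENNReal.ofReal (‖∫ s in a..r, ω s‖ ^ 2 * r ^ (2 * κ - 1)))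
      ≤ ∫⁻ r in Ioo (0:ℝ) 1, ∫⁻ s in Ioo (0:ℝ) 1, F r s := by
        refine setLIntegral_mono' measurableSet_Ioo fun r hr => ?_
        have hr0 := hr.1
        have hpow : (r / 2) ^ (-κ) / κ * r ^ (2 * κ - 1) = 2 ^ κ / κ * r ^ (κ - 1) := by
          rw [Real.div_rpow hr0.le (by norm_num), Real.rpow_neg (by norm_num : (0:ℝ) ≤ 2),
            div_inv_eq_mul, show κ - 1 = -κ + (2 * κ - 1) by ring, Real.rpow_add hr0]
          ring
        rw [ENNReal.ofReal_mul (by positivity), ENNReal.ofReal_pow (norm_nonneg _), ofReal_norm]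
        refine (mul_le_mul_left (enorm_intervalIntegral_sq_le hκ ha hr hω) _).trans ?_
        rw [mul_right_comm, ← ENNReal.ofReal_mul (by positivity), hpow,
          ENNReal.ofReal_mul (by positivity), ← lintegral_const_mul _ hφm,
          ← lintegral_indicator measurableSet_Ioo, ← lintegral_indicator measurableSet_Ioo]
        refine lintegral_mono fun s => indicator_le (fun s hs => ?_) s
        have h1 : s ∈ Ioo (0:ℝ) 1 := ⟨(half_pos hr0).trans hs.1, hs.2⟩
        have h2 : (r, s) ∈ S := by
          have := hs.1
          simp only [hS, mem_ofPred_eq]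
          linarith
        rw [indicator_of_mem h1]
        simp only [hF]
        rw [indicator_of_mem h2]
    _ = ∫⁻ s in Ioo (0:ℝ) 1, ∫⁻ r in Ioo (0:ℝ) 1, F r s :=
        lintegral_lintegral_swap hFm.aemeasurable
    _ ≤ ∫⁻ s in Ioo (0:ℝ) 1, ENNReal.ofReal (2 ^ κ / κ * (2 ^ κ / κ)) *
          ENNReal.ofReal (‖ω s‖ ^ 2 * s ^ (2 * κ - 1)) := by
        refine setLIntegral_mono' measurableSet_Ioo fun s hs => ?_
        have hs0 := hs.1
        calc ∫⁻ r in Ioo (0:ℝ) 1, F r s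
            ≤ ∫⁻ r in Ioo 0 (2 * s), c * φ s * ENNReal.ofReal (r ^ (κ - 1)) := by
              rw [← lintegral_indicator measurableSet_Ioo,
                ← lintegral_indicator measurableSet_Ioo]
              refine lintegral_mono fun r => indicator_le (fun r hr => ?_) r
              by_cases h : (r, s) ∈ S
              · have h1 : r ∈ Ioo 0 (2 * s) := ⟨hr.1, h⟩
                simp only [hF]
                rw [indicator_of_mem h, indicator_of_mem h1, mul_right_comm]
              · simp [hF, h]
          _ = c * φ s * ENNReal.ofReal ((2 * s) ^ κ / κ) := by
              rw [lintegral_const_mul _ (by fun_prop), lintegral_Ioo_zero_rpow hκ (by positivity)]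
          _ ≤ _ := by
              rw [hc, hφ, ← ENNReal.ofReal_mul (by positivity),
                ← ENNReal.ofReal_mul (by positivity), ← ENNReal.ofReal_mul (by positivity)]
              refine ENNReal.ofReal_le_ofReal ?_
              have h1 : s ^ (1 + κ) * s ^ κ ≤ s ^ (2 * κ - 1) := by
                rw [← Real.rpow_add hs0]
                exact Real.rpow_le_rpow_of_exponent_ge hs0 hs.2.le (by linarith)
              rw [Real.mul_rpow (by norm_num) hs0.le]
              calc _ = 2 ^ κ / κ * (2 ^ κ / κ) * (‖ω s‖ ^ 2 * (s ^ (1 + κ) * s ^ κ)) := by ring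
                _ ≤ _ := by gcongr
    _ = _ := lintegral_const_mul _ (by fun_prop)
end

section
/- Let g : (0, 1/2) → [0, ∞) be measurable with ∫₀^{1/2} g(ε) dε < ∞. Then for every δ ∈ (0, 1/2), the set { ε ∈ (0, δ) : g(ε) ≤ 1/(ε · (-log ε)) } has positive Lebesgue measure. Consequently there is a sequence ε_s ∈ (0, 1/2) with ε_s → 0 and ε_s · (-log ε_s) · g(ε_s) ≤ 1 for all s. -/
open MeasureTheory Set Filter

/-- The function `ε ↦ 1 / (ε (-log ε))` is not integrable near `0`. -/
theorem not_integrableOn_one_div_mul_neg_log {δ : ℝ} (hδ : 0 < δ) :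
    ¬ IntegrableOn (fun ε : ℝ => 1 / (ε * (-Real.log ε))) (Ioo 0 δ) := by
  have hderiv : ∀ᶠ x in nhdsWithin (0 : ℝ) (Ioi 0),
      HasDerivAt (fun x => Real.log (-Real.log x)) (-(1 / (x * (-Real.log x)))) x := by
    filter_upwards [Ioo_mem_nhdsGT (zero_lt_one (α := ℝ))] with x hx
    have hlog : Real.log x < 0 := Real.log_neg hx.1 hx.2
    refine ((Real.hasDerivAt_log hx.1.ne').neg.log (neg_pos.2 hlog).ne').congr_deriv ?_
    have hx0 := hx.1.ne'
    have hl0 := hlog.ne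
    simp only [Pi.neg_apply]
    field_simp
  have htop : Tendsto (fun x => ‖Real.log (-Real.log x)‖) (nhdsWithin (0 : ℝ) (Ioi 0)) atTop :=
    tendsto_norm_atTop_atTop.comp <| Real.tendsto_log_atTop.comp <|
      tendsto_neg_atBot_atTop.comp Real.tendsto_log_nhdsGT_zero
  refine not_integrableOn_of_tendsto_norm_atTop_of_deriv_isBigO_filter _ (Ioo_mem_nhdsGT hδ)
    (hderiv.mono fun x hx => hx.differentiableAt) htop ?_
  refine EventuallyEq.trans_isBigO (hderiv.mono fun x hx => hx.deriv) ?_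
  exact (Asymptotics.isBigO_refl _ _).neg_left

/-- L¹ selection lemma (Cheeger): an integrable nonnegative `g` on `(0,1/2)` falls below
the threshold `1/(ε(-log ε))` on a set of positive measure in every interval `(0,δ)`;
consequently there is a sequence `ε_s → 0` with `ε_s (-log ε_s) g(ε_s) ≤ 1`. -/
theorem selection_lemma (g : ℝ → ℝ) (hg : Measurable g)
    (hg0 : ∀ ε ∈ Ioo (0:ℝ) (1/2), 0 ≤ g ε)
    (hgint : IntegrableOn g (Ioo 0 (1/2))) :
    (∀ δ ∈ Ioo (0:ℝ) (1/2),
      0 < volume {ε ∈ Ioo (0:ℝ) δ | g ε ≤ 1 / (ε * (-Real.log ε))}) ∧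
    ∃ ε : ℕ → ℝ, (∀ s, ε s ∈ Ioo (0:ℝ) (1/2)) ∧
      Tendsto ε atTop (nhds 0) ∧
      ∀ s, ε s * (-Real.log (ε s)) * g (ε s) ≤ 1 := by
  have hpos : ∀ δ ∈ Ioo (0:ℝ) (1/2),
      0 < volume {ε ∈ Ioo (0:ℝ) δ | g ε ≤ 1 / (ε * (-Real.log ε))} := by
    rintro δ ⟨hδ, hδ'⟩
    refine pos_iff_ne_zero.2 fun hnull => not_integrableOn_one_div_mul_neg_log hδ ?_
    have hgδ : IntegrableOn g (Ioo 0 δ) := hgint.mono_set (Ioo_subset_Ioo_right hδ'.le)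
    refine Integrable.mono' hgδ (Measurable.aestronglyMeasurable (by fun_prop)) ?_
    rw [ae_restrict_iff' measurableSet_Ioo]
    filter_upwards [measure_eq_zero_iff_ae_notMem.1 hnull] with ε hε hmem
    have hlog : Real.log ε < 0 := Real.log_neg hmem.1 (by linarith [hmem.2])
    have hnonneg : 0 ≤ 1 / (ε * (-Real.log ε)) :=
      one_div_nonneg.2 (mul_nonneg hmem.1.le (neg_nonneg.2 hlog.le))
    rw [Real.norm_of_nonneg hnonneg]
    exact (not_le.1 fun h => hε ⟨hmem, h⟩).le
  refine ⟨hpos, ?_⟩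
  have hδ (s : ℕ) : 1 / ((s : ℝ) + 1) / 3 ∈ Ioo (0:ℝ) (1/2) := by
    have h : 1 / ((s : ℝ) + 1) ≤ 1 := by
      rw [div_le_one (by positivity)]
      linarith [s.cast_nonneg (α := ℝ)]
    exact ⟨by positivity, by linarith⟩
  choose ε hε hgε using fun s : ℕ => nonempty_of_measure_ne_zero (hpos _ (hδ s)).ne'
  refine ⟨ε, fun s => ⟨(hε s).1, (hε s).2.trans (hδ s).2⟩, ?_, fun s => ?_⟩
  · refine squeeze_zero (fun s => (hε s).1.le) (fun s => (hε s).2.le) ?_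
    simpa using tendsto_one_div_add_atTop_nhds_zero_nat (𝕜 := ℝ).div_const 3
  · have hlog : Real.log (ε s) < 0 :=
      Real.log_neg (hε s).1 (by linarith [(hε s).2, (hδ s).2])
    have h := (le_div_iff₀ (mul_pos (hε s).1 (neg_pos.2 hlog))).1 (hgε s)
    rwa [mul_comm] at h
end
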